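/- arXiv:2312.01417 — 3 statements merged into one kernel-verified Lean document; each statement's English description precedes it below -/
import Mathlib

section
/- The Demazure–Lascoux operators satisfy the braid relation: π_i^{(β)} π_{i+1}^{(β)} π_i^{(β)} (f) = π_{i+1}^{(β)} π_i^{(β)} π_{i+1}^{(β)} (f) for all f ∈ Z[β][x_1,...,x_n] and 1 ≤ i ≤ n−2. -/
open MvPolynomial
open Classical in
/-- Divided difference operator: `(f - s_{ij} f) / (X i - X j)`, where `s_{ij}` swaps
the variables `X i` and `X j`.  It is defined as the (unique, since the ring is a domain)
quotient of `f - s_{ij} f` by `X i - X j` whenever the division is exact. -/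
noncomputable def ddiff {n : ℕ} {R : Type} [CommRing R] (i j : Fin n)
    (f : MvPolynomial (Fin n) R) : MvPolynomial (Fin n) R :=
  if h : (X i - X j) ∣ (f - rename (Equiv.swap i j) f) then h.choose else 0

/-- Demazure–Lascoux operator `π_i^{(β)} f = ∂_i (x_i f + β x_i x_{i+1} f)` on
`ℤ[β][x_1, …, x_{m+1}]`, where `β` is the polynomial variable of the coefficient ring. -/
noncomputable def piOp {m : ℕ} (i : Fin m)
    (f : MvPolynomial (Fin (m+1)) (Polynomial ℤ)) : MvPolynomial (Fin (m+1)) (Polynomial ℤ) :=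
  ddiff i.castSucc i.succ
    (X i.castSucc * f + C Polynomial.X * (X i.castSucc * (X i.succ * f)))


theorem ddiff_dvd {n : ℕ} {R : Type} [CommRing R] (i j : Fin n)
    (f : MvPolynomial (Fin n) R) :
    (X i - X j : MvPolynomial (Fin n) R) ∣ (f - rename (Equiv.swap i j) f) := by
  rw [← Ideal.mem_span_singleton, ← Ideal.Quotient.mk_eq_mk_iff_sub_mem]
  set I := Ideal.span {(X i - X j : MvPolynomial (Fin n) R)} with hI
  have hX : Ideal.Quotient.mk I (X i) = Ideal.Quotient.mk I (X j) := by
    rw [Ideal.Quotient.mk_eq_mk_iff_sub_mem]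
    exact Ideal.mem_span_singleton_self _
  have : (Ideal.Quotient.mk I) =
      (Ideal.Quotient.mk I).comp (rename (Equiv.swap i j) :
        MvPolynomial (Fin n) R →ₐ[R] MvPolynomial (Fin n) R).toRingHom := by
    apply MvPolynomial.ringHom_ext
    · intro r
      simp
    · intro k
      simp only [RingHom.comp_apply, AlgHom.toRingHom_eq_coe, RingHom.coe_coe, rename_X]
      by_cases h1 : k = i
      · subst h1; rw [Equiv.swap_apply_left, hX]
      · by_cases h2 : k = j
        · subst h2; rw [Equiv.swap_apply_right, hX]
        · rw [Equiv.swap_apply_of_ne_of_ne h1 h2]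
  exact congrArg (fun g => g f) this

theorem ddiff_spec {n : ℕ} {R : Type} [CommRing R] (i j : Fin n)
    (f : MvPolynomial (Fin n) R) :
    (X i - X j) * ddiff i j f = f - rename (Equiv.swap i j) f := by
  have h := ddiff_dvd i j f
  rw [ddiff, dif_pos h]
  exact h.choose_spec.symm

theorem braid_alg {A : Type*} [CommRing A] [IsDomain A] (s t : A →+* A) (x y z β : A)
    (hxy : x - y ≠ 0) (hyz : y - z ≠ 0) (hxz : x - z ≠ 0)
    (sx : s x = y) (sy : s y = x) (sz : s z = z) (sb : s β = β)
    (tx : t x = x) (ty : t y = z) (tz : t z = y) (tb : t β = β)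
    (f p q r p' q' r' : A) (hst : s (t (s f)) = t (s (t f)))
    (h1 : (x - y) * p = x * (1 + β * y) * f - y * (1 + β * x) * s f)
    (h2 : (y - z) * q = y * (1 + β * z) * p - z * (1 + β * y) * t p)
    (h3 : (x - y) * r = x * (1 + β * y) * q - y * (1 + β * x) * s q)
    (k1 : (y - z) * p' = y * (1 + β * z) * f - z * (1 + β * y) * t f)
    (k2 : (x - y) * q' = x * (1 + β * y) * p' - y * (1 + β * x) * s p')
    (k3 : (y - z) * r' = y * (1 + β * z) * q' - z * (1 + β * y) * t q')
    (ss : s (s f) = f) (tt : t (t f) = f) : r = r' := by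
  have h1t := congrArg t h1
  have h1s := congrArg s h1
  have h1st := congrArg s h1t
  have h2s := congrArg s h2
  have k1s := congrArg s k1
  have k1t := congrArg t k1
  have k1ts := congrArg t k1s
  have k2t := congrArg t k2
  simp only [map_mul, map_sub, map_add, map_one, sx, sy, sz, sb, tx, ty, tz, tb, ss, tt, hst]
    at h1t h1s h1st h2s k1s k1t k1ts k2t
  have hK : (x - y) * (y - z) * (x - z) * (x - y) * (y - z) ≠ 0 := by
    simp [hxy, hyz, hxz]
  apply mul_left_cancel₀ hK
  linear_combination (y - z) * ((x-y)*(y-z)*(x-z)*h3 + x*(1+β*y)*(x-y)*(x-z)*h2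
      - y*(1+β*x)*(x-y)*(y-z)*h2s + x*(1+β*y)*(x-z)*(y*(1+β*z))*h1
      - x*(1+β*y)*(z*(1+β*y))*(x-y)*h1t + y*(1+β*x)*(y-z)*(x*(1+β*z))*h1s
      + y*(1+β*x)*(x-y)*(z*(1+β*x))*h1st)
    - (x - y) * ((x-y)*(y-z)*(x-z)*k3 + y*(1+β*z)*(y-z)*(x-z)*k2
      - z*(1+β*y)*(y-z)*(x-y)*k2t + y*(1+β*z)*(x*(1+β*y))*(x-z)*k1
      - y*(1+β*z)*(y*(1+β*x))*(y-z)*k1s + z*(1+β*y)*(x*(1+β*z))*(x-y)*k1t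
      + z*(1+β*y)*(z*(1+β*x))*(y-z)*k1ts)

theorem piOp_spec {m : ℕ} (i : Fin m) (f : MvPolynomial (Fin (m+1)) (Polynomial ℤ)) :
    (X i.castSucc - X i.succ) * piOp i f =
      X i.castSucc * (1 + C Polynomial.X * X i.succ) * f
      - X i.succ * (1 + C Polynomial.X * X i.castSucc) *
        rename (Equiv.swap i.castSucc i.succ) f := by
  rw [piOp, ddiff_spec]
  simp only [map_add, map_mul, rename_X, rename_C, Equiv.swap_apply_left, Equiv.swap_apply_right]
  ring

theorem piOp_braid (m : ℕ) (i j : Fin m) (hij : (j : ℕ) = (i : ℕ) + 1)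
    (f : MvPolynomial (Fin (m+1)) (Polynomial ℤ)) :
    piOp i (piOp j (piOp i f)) = piOp j (piOp i (piOp j f)) := by
  have hb : j.castSucc = i.succ := by ext; simp [hij]
  have S1 := piOp_spec i
  have S2 := piOp_spec j
  rw [hb] at S2
  have hab : i.castSucc ≠ i.succ := by simp [Fin.ext_iff]
  have hbc : i.succ ≠ j.succ := by simp [Fin.ext_iff, hij]
  have hac : i.castSucc ≠ j.succ := by simp [Fin.ext_iff, hij]; omega
  generalize i.castSucc = a at *
  generalize i.succ = b at *
  generalize j.succ = c at *
  have hne : ∀ u v : Fin (m+1), u ≠ v →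
      (X u - X v : MvPolynomial (Fin (m+1)) (Polynomial ℤ)) ≠ 0 := fun u v h h' =>
    h (X_injective (sub_eq_zero.mp h'))
  refine braid_alg
    (rename (R := Polynomial ℤ) (Equiv.swap a b)).toRingHom
    (rename (R := Polynomial ℤ) (Equiv.swap b c)).toRingHom
    (X a) (X b) (X c) (C Polynomial.X) (hne _ _ hab) (hne _ _ hbc) (hne _ _ hac)
    ?_ ?_ ?_ ?_ ?_ ?_ ?_ ?_ f _ _ _ _ _ _ ?_ (S1 _) (S2 _) (S1 _) (S2 _) (S1 _) (S2 _) ?_ ?_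
  · simp
  · simp
  · simp [Equiv.swap_apply_of_ne_of_ne hac.symm hbc.symm]
  · simp
  · simp [Equiv.swap_apply_of_ne_of_ne hab hac]
  · simp
  · simp
  · simp
  · simp only [AlgHom.toRingHom_eq_coe, RingHom.coe_coe, rename_rename]
    congr 2
    funext k
    simp only [Function.comp_apply, Equiv.swap_apply_def]
    grind
  · simp only [AlgHom.toRingHom_eq_coe, RingHom.coe_coe, rename_rename]
    rw [← Equiv.coe_trans]; simp [rename_id]
  · simp only [AlgHom.toRingHom_eq_coe, RingHom.coe_coe, rename_rename]
    rw [← Equiv.coe_trans]; simp [rename_id]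
end

section
/- Every Lascoux polynomial L_{w,λ} has nonnegative integer coefficients (as a polynomial in Z[β][x_1,...,x_n]). -/
open MvPolynomial
/-- Apply a word of Demazure–Lascoux operators, leftmost letter first:
`piWord [i₁, …, i_k] f = π_{i_k}^{(β)} ⋯ π_{i_1}^{(β)} f`. -/
noncomputable def piWord {m : ℕ} (l : List (Fin m))
    (f : MvPolynomial (Fin (m+1)) (Polynomial ℤ)) : MvPolynomial (Fin (m+1)) (Polynomial ℤ) :=
  l.foldl (fun g i => piOp i g) f

/-- The simple transposition `s_i` swapping `i` and `i+1`, as a permutation of `Fin (m+1)`. -/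
def toSwap {m : ℕ} (i : Fin m) : Equiv.Perm (Fin (m+1)) := Equiv.swap i.castSucc i.succ

/-- `l` is a reduced word for the permutation `w`: its product is `w` and it has
minimal length among all such words in the simple transpositions. -/
def IsReducedWord {m : ℕ} (l : List (Fin m)) (w : Equiv.Perm (Fin (m+1))) : Prop :=
  (l.map toSwap).prod = w ∧
    ∀ l₂ : List (Fin m), (l₂.map toSwap).prod = w → l.length ≤ l₂.length


namespace Lsc

abbrev A := MvPolynomial ℕ (Polynomial ℤ)

/-- the parameter beta -/
noncomputable def bt : A := C Polynomial.X

theorem dvd_sub_swap {σ R : Type} [DecidableEq σ] [CommRing R] (i j : σ)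
    (f : MvPolynomial σ R) : (X i - X j) ∣ (f - rename (Equiv.swap i j) f) := by
  induction f using MvPolynomial.induction_on with
  | C a => simp
  | add p q hp hq =>
    rw [map_add, add_sub_add_comm]
    exact dvd_add hp hq
  | mul_X p k hp =>
    have h2 : (X i - X j : MvPolynomial σ R) ∣ X k - X (Equiv.swap i j k) := by
      by_cases h : k = i
      · subst h; simp
      · by_cases h' : k = j
        · subst h'
          rw [Equiv.swap_apply_right]
          exact ⟨-1, by ring⟩
        · rw [Equiv.swap_apply_of_ne_of_ne h h']; simp
    have : p * X k - rename (Equiv.swap i j) (p * X k) =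
        (p - rename (Equiv.swap i j) p) * X k
          + rename (Equiv.swap i j) p * (X k - X (Equiv.swap i j k)) := by
      rw [map_mul, rename_X]; ring
    rw [this]
    exact dvd_add (Dvd.dvd.mul_right hp _) (Dvd.dvd.mul_left h2 _)

noncomputable def s (i : ℕ) : A →ₐ[Polynomial ℤ] A := rename (Equiv.swap i (i+1))

@[simp] theorem s_bt (i : ℕ) : s i bt = bt := by simp [s, bt]
@[simp] theorem s_X1 (i : ℕ) : s i (X i) = X (i+1) := by simp [s]
@[simp] theorem s_X2 (i : ℕ) : s i (X (i+1)) = X i := by simp [s]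
theorem s_X3 (i k : ℕ) (h : k ≠ i) (h' : k ≠ i+1) : s i (X k) = X k := by
  simp [s, Equiv.swap_apply_of_ne_of_ne h h']
@[simp] theorem s_s (i : ℕ) (f : A) : s i (s i f) = f := by
  simp only [s, rename_rename]
  rw [← Equiv.coe_trans, Equiv.swap_swap]
  simp
theorem s_comm (i j : ℕ) (h : i + 1 < j) (f : A) : s i (s j f) = s j (s i f) := by
  simp only [s, rename_rename]
  congr 2
  funext k
  simp only [Function.comp, Equiv.swap_apply_def]
  split_ifs <;> omega
theorem s_braid (i : ℕ) (f : A) : s i (s (i+1) (s i f)) = s (i+1) (s i (s (i+1) f)) := by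
  simp only [s, rename_rename]
  congr 2
  funext k
  simp only [Function.comp, Equiv.swap_apply_def]
  split_ifs <;> omega

theorem D_ne {i j : ℕ} (h : i ≠ j) : (X i - X j : A) ≠ 0 := by
  rw [sub_ne_zero]
  exact fun e => h (X_injective e)

theorem pi_exists (i : ℕ) (f : A) : ∃ g : A, (X i - X (i+1)) * g =
    X i * (1 + bt * X (i+1)) * f - X (i+1) * (1 + bt * X i) * s i f := by
  obtain ⟨g, hg⟩ := dvd_sub_swap i (i+1) (X i * (1 + bt * X (i+1)) * f)
  refine ⟨g, ?_⟩
  rw [← hg]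
  have : rename (Equiv.swap i (i+1)) (X i * (1 + bt * X (i+1)) * f)
    = s i (X i * (1 + bt * X (i+1)) * f) := rfl
  rw [this]
  simp

noncomputable def p (i : ℕ) (f : A) : A := (pi_exists i f).choose

theorem p_spec (i : ℕ) (f : A) : (X i - X (i+1)) * p i f =
    X i * (1 + bt * X (i+1)) * f - X (i+1) * (1 + bt * X i) * s i f :=
  (pi_exists i f).choose_spec

theorem p_uniq {i : ℕ} {f g : A} (h : (X i - X (i+1)) * g =
    X i * (1 + bt * X (i+1)) * f - X (i+1) * (1 + bt * X i) * s i f) : p i f = g :=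
  mul_left_cancel₀ (D_ne (by omega : i ≠ i+1)) ((p_spec i f).trans h.symm)

theorem p_add (i : ℕ) (f g : A) : p i (f + g) = p i f + p i g := by
  apply p_uniq
  rw [map_add]
  linear_combination p_spec i f + p_spec i g

theorem p_mul (i : ℕ) (g f : A) (h : s i g = g) : p i (g * f) = g * p i f := by
  apply p_uniq
  rw [map_mul, h]
  linear_combination g * p_spec i f

theorem p_zero (i : ℕ) : p i 0 = 0 := by
  have := p_mul i 0 0 (by simp)
  simpa using this

theorem s_p (i : ℕ) (f : A) : s i (p i f) = p i f := by
  symm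
  apply p_uniq
  have := congrArg (s i) (p_spec i f)
  simp at this
  linear_combination -this

theorem p_idem (i : ℕ) (f : A) : p i (p i f) = p i f := by
  apply p_uniq
  rw [s_p]
  ring

theorem p_comm (i j : ℕ) (h : i + 1 < j) (f : A) : p i (p j f) = p j (p i f) := by
  apply mul_left_cancel₀ (D_ne (by omega : i ≠ i+1))
  apply mul_left_cancel₀ (D_ne (by omega : j ≠ j+1))
  have e1 := p_spec i (p j f)
  have e2 := p_spec j (p i f)
  have e3 := congrArg (s i) (p_spec j f)
  have e4 := congrArg (s j) (p_spec i f)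
  have e5 := p_spec i f
  have e6 := p_spec j f
  simp only [map_mul, map_sub, map_add, map_one, s_bt, s_X3 i j (by omega) (by omega),
    s_X3 i (j+1) (by omega) (by omega)] at e3
  simp only [map_mul, map_sub, map_add, map_one, s_bt, s_X3 j i (by omega) (by omega),
    s_X3 j (i+1) (by omega) (by omega)] at e4
  rw [s_comm i j h] at e3
  linear_combination (X j - X (j+1)) * e1 - (X i - X (i+1)) * e2
    + X i * (1 + bt * X (i+1)) * e6 - X (i+1) * (1 + bt * X i) * e3
    - X j * (1 + bt * X (j+1)) * e5 + X (j+1) * (1 + bt * X j) * e4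

theorem p_braid (i : ℕ) (f : A) : p i (p (i+1) (p i f)) = p (i+1) (p i (p (i+1) f)) := by
  have d1 : (X i - X (i+1) : A) ≠ 0 := D_ne (by omega)
  have d2 : (X (i+1) - X (i+2) : A) ≠ 0 := D_ne (by omega)
  have d3 : (X i - X (i+2) : A) ≠ 0 := D_ne (by omega)
  have x3 : s i (X (i+2)) = X (i+2) := s_X3 _ _ (by omega) (by omega)
  have x4 : s (i+1) (X i) = X i := s_X3 _ _ (by omega) (by omega)
  have x5 : s (i+1) (X (i+1)) = X (i+2) := s_X1 _
  have x6 : s (i+1) (X (i+2)) = X (i+1) := s_X2 _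
  have a1 := p_spec i f
  have a2 := congrArg (s (i+1)) a1
  have a3 := congrArg (s i) a2
  have a4 := p_spec (i+1) (p i f)
  have a5 := congrArg (s i) a4
  have a6 := p_spec i (p (i+1) (p i f))
  have b1 := p_spec (i+1) f
  have b2 := congrArg (s i) b1
  have b3 := congrArg (s (i+1)) b2
  have b4 := p_spec i (p (i+1) f)
  have b5 := congrArg (s (i+1)) b4
  have b6 := p_spec (i+1) (p i (p (i+1) f))
  simp only [map_mul, map_sub, map_add, map_one, s_bt, s_X1, s_X2, x3, x4, x5, x6, s_p,
    show i + 1 + 1 = i + 2 from rfl, s_braid] at a1 a2 a3 a4 a5 a6 b1 b2 b3 b4 b5 b6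
  generalize p i (p (i+1) (p i f)) = P at *
  generalize p (i+1) (p i (p (i+1) f)) = Q at *
  generalize s i (p (i+1) (p i f)) = P1 at *
  generalize s (i+1) (p i (p (i+1) f)) = Q1 at *
  generalize (p (i+1) (p i f)) = P2 at *
  generalize (p i (p (i+1) f)) = Q2 at *
  generalize s i (s (i+1) (p i f)) = P3 at *
  generalize s (i+1) (s i (p (i+1) f)) = Q3 at *
  generalize (s (i+1) (p i f)) = P4 at *
  generalize (s i (p (i+1) f)) = Q4 at *
  generalize (p i f) = P5 at *
  generalize (p (i+1) f) = Q5 at *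
  generalize s (i+1) (s i (s (i+1) f)) = f6 at *
  generalize s (i+1) (s i f) = f5 at *
  generalize s i (s (i+1) f) = f4 at *
  generalize s i f = f3 at *
  generalize s (i+1) f = f2 at *
  generalize (X i : A) = x at *
  generalize (X (i+1) : A) = y at *
  generalize (X (i+2) : A) = z at *
  generalize bt = b at *
  -- clear denominators
  apply mul_left_cancel₀ d1
  apply mul_left_cancel₀ d2
  apply mul_left_cancel₀ d3
  apply mul_left_cancel₀ d1
  apply mul_left_cancel₀ d2
  apply mul_left_cancel₀ d3
  have hP : (x - z) * ((y - z) * ((x - y) * ((x - z) * ((y - z) * ((x - y) * P))))) =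
     (x-y)*(y-z)*(x-z) * ( (x-z) * (x * (1 + b * y)) * (y * (1 + b * z) * P5 - z * (1 + b * y) * P4)
       - (y - z) * (y * (1 + b * x)) * (x * (1 + b * z) * P5 - z * (1 + b * x) * P3)) := by
    linear_combination (x-y)*(y-z)*(x-z)*((y-z)*(x-z)*a6
      + (x-z) * (x * (1 + b * y)) * a4 - (y - z) * (y * (1 + b * x)) * a5)
  have hQ : (x - z) * ((y - z) * ((x - y) * ((x - z) * ((y - z) * ((x - y) * Q))))) =
     (x-y)*(y-z)*(x-z) * ( (x-z) * (y * (1 + b * z)) * (x * (1 + b * y) * Q5 - y * (1 + b * x) * Q4)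
       - (x - y) * (z * (1 + b * y)) * (x * (1 + b * z) * Q5 - z * (1 + b * x) * Q3)) := by
    linear_combination (x-y)*(y-z)*(x-z)*((x-y)*(x-z)*b6
      + (x-z) * (y * (1 + b * z)) * b4 - (x - y) * (z * (1 + b * y)) * b5)
  rw [hP, hQ]
  linear_combination ((y-z)*(x-z)*((x-z) * (x * (1 + b * y)) * (y * (1 + b * z))
      - (y - z) * (y * (1 + b * x)) * (x * (1 + b * z)))) * a1
    - ((x-y)*(y-z)*(x-z) * (x * (1 + b * y)) * z * (1 + b * y)) * a2
    + (x-y)*(x-z)*(y - z) * (y * (1 + b * x)) * z * (1 + b * x) * a3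
    - ((x-y)*(x-z)*((x-z) * (y * (1 + b * z)) * (x * (1 + b * y))
      - (x - y) * (z * (1 + b * y)) * (x * (1 + b * z)))) * b1
    + ((x-y)*(y-z)*(x-z) * (y * (1 + b * z)) * y * (1 + b * x)) * b2
    - (y-z)*(x-z)*(x - y) * (z * (1 + b * y)) * z * (1 + b * x) * b3

end Lsc

namespace Lsc

/-! ### The symmetric two-variable sums -/

/-- `E a u v = ∑_{t ≤ a} u^t v^(a-t) + β u v ∑_{t < a} u^t v^(a-1-t)`, defined recursively. -/
noncomputable def E : ℕ → A → A → A
  | 0, _, _ => 1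
  | a+1, u, v => v * E a u v + u^(a+1) * (1 + bt * v)

theorem E_succ (a : ℕ) (u v : A) :
    E (a+1) u v = v * E a u v + u^(a+1) * (1 + bt * v) := rfl

theorem E_spec (a : ℕ) (u v : A) :
    (u - v) * E a u v = u^(a+1) * (1 + bt * v) - v^(a+1) * (1 + bt * u) := by
  induction a with
  | zero => simp only [E]; ring
  | succ a ih => simp only [E]; linear_combination v * ih

theorem s_E (i a : ℕ) (u v : A) : s i (E a u v) = E a (s i u) (s i v) := by
  induction a with
  | zero => simp [E]
  | succ a ih => simp [E, ih]

theorem p_XX (i a l : ℕ) : p i (X i ^ (l + a) * X (i+1) ^ l)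
    = (X i * X (i+1)) ^ l * E a (X (i+1)) (X i) := by
  apply p_uniq
  have := E_spec a (X (i+1)) (X i)
  simp only [map_mul, map_pow, s_X1, s_X2]
  linear_combination (-(X i * X (i+1)) ^ l) * this

/-- the polynomial obtained from `E a w x` by replacing `w^k` by `E (b+k) w z`. -/
noncomputable def Phi (b : ℕ) (x w z : A) : ℕ → A
  | 0 => E b w z
  | a+1 => x * Phi b x w z a + (1 + bt * x) * E (b+a+1) w z

theorem Phi_spec (b : ℕ) (x w z : A) (a : ℕ) : (w - z) * Phi b x w z a =
    (1 + bt * z) * w^(b+1) * E a w x - (1 + bt * w) * z^(b+1) * E a z x := by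
  induction a with
  | zero => simp only [Phi, E]; linear_combination E_spec b w z
  | succ a ih =>
    rw [Phi, E_succ a w x, E_succ a z x]
    linear_combination x * ih + (1 + bt * x) * E_spec (b+a+1) w z

theorem key (i n a b : ℕ) (hn : i + 1 < n) :
    Phi b (X i) (X (i+1)) (X n) a =
      (E b (X (i+1)) (X n) - X (i+1) ^ b) * E a (X i) (X n)
        + X (i+1) ^ b * p i (E a (X i) (X n)) := by
  have d1 : (X i - X (i+1) : A) ≠ 0 := D_ne (by omega)
  have d2 : (X (i+1) - X n : A) ≠ 0 := D_ne (by omega)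
  have d3 : (X i - X n : A) ≠ 0 := D_ne (by omega)
  have e1 := p_spec i (E a (X i) (X n))
  rw [s_E, s_X1, s_X3 i n (by omega) (by omega)] at e1
  have e2 := Phi_spec b (X i) (X (i+1)) (X n) a
  have e3 := E_spec a (X (i+1)) (X i)
  have e4 := E_spec a (X n) (X i)
  have e5 := E_spec a (X i) (X n)
  have e6 := E_spec a (X (i+1)) (X n)
  have e7 := E_spec b (X (i+1)) (X n)
  apply mul_left_cancel₀ d1
  apply mul_left_cancel₀ d2
  apply mul_left_cancel₀ d3
  generalize p i (E a (X i) (X n)) = P at *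
  generalize Phi b (X i) (X (i+1)) (X n) a = F at *
  generalize E a (X (i+1)) (X i) = E1 at *
  generalize E a (X n) (X i) = E2 at *
  generalize E a (X i) (X n) = E3 at *
  generalize E a (X (i+1)) (X n) = E4 at *
  generalize E b (X (i+1)) (X n) = E5 at *
  generalize (X i : A) = x at *
  generalize (X (i+1) : A) = w at *
  generalize (X n : A) = z at *
  generalize bt = t at *
  linear_combination (x - w) * (x - z) * e2 - (x - z) * (1 + t * z) * w^(b+1) * e3
    + (x - w) * (1 + t * w) * z^(b+1) * e4
    - (w - z) * (x - z) * w^b * e1 - (x - w) * (x - z) * E3 * e7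
    + (x - z) * w^b * w * (1 + t * x) * e6
    + (-(x - w) * (w^(b+1)*(1+t*z) - z^(b+1) *(1+t*w) - (w-z)*w^b)
       - (w - z) * w^b * x * (1 + t * w)) * e5

/-! ### Words and the cone -/

noncomputable def Wd (l : List ℕ) (f : A) : A := l.foldl (fun g i => p i g) f

@[simp] theorem Wd_nil (f : A) : Wd [] f = f := rfl
@[simp] theorem Wd_cons (i : ℕ) (l : List ℕ) (f : A) : Wd (i :: l) f = Wd l (p i f) := rfl

theorem Wd_add (l : List ℕ) (f g : A) : Wd l (f + g) = Wd l f + Wd l g := by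
  induction l generalizing f g with
  | nil => rfl
  | cons i l ih => simp [p_add, ih]

theorem Wd_zero (l : List ℕ) : Wd l 0 = 0 := by
  induction l with
  | nil => rfl
  | cons i l ih => simp [p_zero, ih]

theorem Wd_mul (l : List ℕ) (g f : A) (h : ∀ i ∈ l, s i g = g) : Wd l (g * f) = g * Wd l f := by
  induction l generalizing f with
  | nil => rfl
  | cons i l ih =>
    simp only [Wd_cons]
    rw [p_mul i g f (h i (by simp)), ih]
    exact fun k hk => h k (by simp [hk])

noncomputable def mono (k : ℕ) (μ : ℕ → ℕ) : A := ∏ i ∈ Finset.range k, X i ^ μ i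

/-- nonnegative polynomials -/
noncomputable def NN : Subsemiring A :=
  (MvPolynomial.map (σ := ℕ) (Polynomial.mapRingHom (Nat.castRingHom ℤ))).rangeS

theorem NN_X (i : ℕ) : (X i : A) ∈ NN := ⟨X i, by simp⟩
theorem NN_bt : bt ∈ NN := ⟨C Polynomial.X, by simp [bt]⟩

theorem NN_coeff {f : A} (h : f ∈ NN) (mo : ℕ →₀ ℕ) (d : ℕ) : 0 ≤ (coeff mo f).coeff d := by
  obtain ⟨g, rfl⟩ := h
  simp [coeff_map]

def Pos (k : ℕ) : Prop := ∀ μ : ℕ → ℕ, (∀ i, i + 1 < k → μ (i+1) ≤ μ i) →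
  ∀ l : List ℕ, (∀ i ∈ l, i + 1 < k) → Wd l (mono k μ) ∈ NN

inductive K (N k b : ℕ) : A → Prop
  | mono (μ : ℕ → ℕ) (h : ∀ i, i + 1 < k → μ (i+1) ≤ μ i) (hb : ∀ i, i < k → b ≤ μ i) :
      K N k b (mono k μ)
  | pi (i : ℕ) (f : A) (hi : i + 1 < k) (hf : K N k b f) : K N k b (p i f)
  | zero : K N k b 0
  | add (f g : A) (hf : K N k b f) (hg : K N k b g) : K N k b (f + g)
  | zmul (f : A) (hf : K N k b f) : K N k b (X N * f)
  | bmul (f : A) (hf : K N k b f) : K N k b (bt * f)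

theorem K_good {N k b : ℕ} (hk : k ≤ N) (hP : Pos k) {f : A} (hf : K N k b f) :
    ∀ l : List ℕ, (∀ i ∈ l, i + 1 < k) → Wd l f ∈ NN := by
  induction hf with
  | mono μ h hb => exact hP μ h
  | pi i f hi hf ih =>
    intro l hl
    exact ih (i :: l) (by simpa using ⟨hi, hl⟩)
  | zero => intro l _; rw [Wd_zero]; exact NN.zero_mem
  | add f g _ _ h1 h2 => intro l hl; rw [Wd_add]; exact NN.add_mem (h1 l hl) (h2 l hl)
  | zmul f _ ih =>
    intro l hl
    rw [Wd_mul]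
    · exact NN.mul_mem (NN_X N) (ih l hl)
    · intro i hi
      have := hl i hi
      exact s_X3 _ _ (by omega) (by omega)
  | bmul f _ ih =>
    intro l hl
    rw [Wd_mul]
    · exact NN.mul_mem NN_bt (ih l hl)
    · intro i hi; simp

theorem K_weaken {N k b b' : ℕ} (h : b' ≤ b) {f : A} (hf : K N k b f) : K N k b' f := by
  induction hf with
  | mono μ h1 hb => exact K.mono μ h1 (fun i hi => h.trans (hb i hi))
  | pi i f hi hf ih => exact K.pi i f hi ih
  | zero => exact K.zero
  | add f g _ _ h1 h2 => exact K.add _ _ h1 h2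
  | zmul f _ ih => exact K.zmul _ ih
  | bmul f _ ih => exact K.bmul _ ih

theorem K_zpow {N k b e : ℕ} {f : A} (hf : K N k b f) : K N k b (X N ^ e * f) := by
  induction e with
  | zero => simpa using hf
  | succ e ih =>
    have : (X N ^ (e+1) * f : A) = X N * (X N ^ e * f) := by ring
    rw [this]; exact K.zmul _ ih

theorem K_X {N k b b' e : ℕ} (h1 : b' ≤ e) (h2 : e ≤ b) {f : A}
    (hf : K N k b f) : K N (k+1) b' (X k ^ e * f) := by
  induction hf with
  | mono μ h hb =>
    have : X k ^ e * mono k μ = mono (k+1) (Function.update μ k e) := by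
      unfold Lsc.mono
      rw [Finset.prod_range_succ, mul_comm, Function.update_self]
      congr 1
      apply Finset.prod_congr rfl
      intro i hi
      rw [Function.update_of_ne]
      have := Finset.mem_range.1 hi
      omega
    rw [this]
    apply K.mono
    · intro i hi
      rw [Function.update_of_ne (by omega : i ≠ k)]
      by_cases hk : i + 1 = k
      · subst hk
        rw [Function.update_self]
        exact h2.trans (hb i (by omega))
      · rw [Function.update_of_ne hk]
        exact h i (by omega)
    · intro i hi
      by_cases hk : i = k
      · subst hk
        rwa [Function.update_self]
      · rw [Function.update_of_ne hk]
        exact (h1.trans h2).trans (hb i (by omega))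
  | pi i f hi hf ih =>
    rw [← p_mul]
    · exact K.pi _ _ (by omega) ih
    · rw [map_pow, s_X3 _ _ (by omega) (by omega)]
  | zero => rw [mul_zero]; exact K.zero
  | add f g _ _ h1 h2 => rw [mul_add]; exact K.add _ _ h1 h2
  | zmul f _ ih => rw [mul_left_comm]; exact K.zmul _ ih
  | bmul f _ ih => rw [mul_left_comm]; exact K.bmul _ ih

theorem K_E {N k b b' a : ℕ} (h : b' + a ≤ b) {f : A} (hf : K N k b f) :
    K N (k+1) b' (X k ^ b' * (E a (X k) (X N) - X k ^ a) * f) := by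
  induction a with
  | zero => simp only [E, pow_zero, sub_self, mul_zero, zero_mul]; exact K.zero
  | succ a ih =>
    have : X k ^ b' * (E (a+1) (X k) (X N) - X k ^ (a+1)) * f =
      X N * (X k ^ b' * (E a (X k) (X N) - X k ^ a) * f) + (X N * (X k ^ (b' + a) * f)
        + bt * (X N * (X k ^ (b'+a+1) * f))) := by
      simp only [E]; ring
    rw [this]
    refine K.add _ _ (K.zmul _ (ih (by omega))) (K.add _ _ (K.zmul _ ?_) (K.bmul _ (K.zmul _ ?_)))
    · exact K_X (by omega) (by omega) hf
    · exact K_X (by omega) (by omega) hf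

/-! ### Cycles and normal forms of words -/

noncomputable def c : ℕ → ℕ → A → A
  | 0, _, f => f
  | d+1, j, f => c d (j+1) (p j f)

theorem c_zero (j : ℕ) (f : A) : c 0 j f = f := rfl
theorem c_succ (d j : ℕ) (f : A) : c (d+1) j f = c d (j+1) (p j f) := rfl

theorem c_add (d j : ℕ) (f g : A) : c d j (f + g) = c d j f + c d j g := by
  induction d generalizing j f g with
  | zero => rw [c_zero, c_zero, c_zero]
  | succ d ih => rw [c_succ, c_succ, c_succ, p_add, ih]

theorem c_mul (d j : ℕ) (g f : A) (h : ∀ i, j ≤ i → s i g = g) : c d j (g * f) = g * c d j f := by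
  induction d generalizing j f with
  | zero => rw [c_zero, c_zero]
  | succ d ih =>
    rw [c_succ, c_succ]
    rw [p_mul j g f (h j le_rfl), ih]
    exact fun i hi => h i (by omega)

theorem c_comm (d j i : ℕ) (h : i + 1 < j) (f : A) : c d j (p i f) = p i (c d j f) := by
  induction d generalizing j f with
  | zero => rw [c_zero, c_zero]
  | succ d ih =>
    rw [c_succ, c_succ]
    rw [← p_comm i j h, ih _ (by omega)]

theorem c_shift (d j i : ℕ) (h : j ≤ i) (h' : i + 1 < j + d) (f : A) :
    c d j (p (i+1) f) = p i (c d j f) := by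
  induction d generalizing j f with
  | zero => omega
  | succ d ih =>
    rw [c_succ, c_succ]
    rcases h.eq_or_lt with rfl | hlt
    · obtain ⟨d, rfl⟩ : ∃ e, d = e + 1 := ⟨d - 1, by omega⟩
      rw [c_succ, c_succ]
      rw [← p_braid, c_comm _ _ _ (by omega)]
    · rw [p_comm j (i+1) (by omega), ih _ (by omega) (by omega)]

theorem normal_form (N : ℕ) (l : List ℕ) (hl : ∀ i ∈ l, i < N) :
    ∃ (u : List ℕ) (j d : ℕ), (∀ i ∈ u, i + 1 < N) ∧ j + d = N ∧
      ∀ f, Wd l f = Wd u (c d j f) := by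
  induction l with
  | nil => exact ⟨[], N, 0, by simp, rfl, fun f => rfl⟩
  | cons i l ih =>
    obtain ⟨u, j, d, hu, hj, hf⟩ := ih (fun k hk => hl k (by simp [hk]))
    have hi := hl i (by simp)
    rcases lt_trichotomy (i+1) j with h | h | h
    · refine ⟨i :: u, j, d, ?_, hj, fun f => ?_⟩
      · simpa using ⟨by omega, hu⟩
      · rw [Wd_cons, hf, c_comm _ _ _ h, Wd_cons]
    · refine ⟨u, i, d+1, hu, by omega, fun f => ?_⟩
      rw [Wd_cons, hf, ← h, c_succ]
    · rcases Nat.lt_or_ge j i with h2 | h2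
      · obtain ⟨i, rfl⟩ : ∃ e, i = e + 1 := ⟨i - 1, by omega⟩
        refine ⟨i :: u, j, d, ?_, hj, fun f => ?_⟩
        · simpa using ⟨by omega, hu⟩
        · rw [Wd_cons, hf, c_shift _ _ _ (by omega) (by omega), Wd_cons]
      · have : i = j := by omega
        subst this
        obtain ⟨d, rfl⟩ : ∃ e, d = e + 1 := ⟨d - 1, by omega⟩
        refine ⟨u, i, d+1, hu, hj, fun f => ?_⟩
        rw [Wd_cons, hf]
        rw [c_succ, c_succ, p_idem]

/-! ### The branching operator -/

noncomputable def G (lam : ℕ → ℕ) : ℕ → ℕ → A → A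
  | 0, j, f => X (j+1) ^ lam (j+1) * f
  | d+1, j, f => G lam d (j+1)
      (X (j+1) ^ lam (j+2) * (E (lam (j+1) - lam (j+2)) (X (j+1)) (X (j+d+2))
          - X (j+1) ^ (lam (j+1) - lam (j+2))) * f + p j (X (j+1) ^ lam (j+1) * f))

theorem G_zero (lam : ℕ → ℕ) (j : ℕ) (f : A) :
    G lam 0 j f = X (j+1) ^ lam (j+1) * f := rfl
theorem G_succ (lam : ℕ → ℕ) (d j : ℕ) (f : A) : G lam (d+1) j f = G lam d (j+1)
      (X (j+1) ^ lam (j+2) * (E (lam (j+1) - lam (j+2)) (X (j+1)) (X (j+d+2))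
          - X (j+1) ^ (lam (j+1) - lam (j+2))) * f + p j (X (j+1) ^ lam (j+1) * f)) := rfl

theorem G_add (lam : ℕ → ℕ) (d j : ℕ) (f g : A) :
    G lam d j (f + g) = G lam d j f + G lam d j g := by
  induction d generalizing j f g with
  | zero => rw [G_zero, G_zero, G_zero, mul_add]
  | succ d ih =>
    rw [G_succ, G_succ, G_succ, ← ih, mul_add, mul_add, p_add, add_add_add_comm]

theorem G_mul (lam : ℕ → ℕ) (d j : ℕ) (g f : A) (h : ∀ i, j ≤ i → s i g = g) :
    G lam d j (g * f) = g * G lam d j f := by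
  induction d generalizing j f with
  | zero => rw [G_zero, G_zero, mul_left_comm]
  | succ d ih =>
    have e : X (j+1) ^ lam (j+1) * (g * f) = g * (X (j+1) ^ lam (j+1) * f) := mul_left_comm _ _ _
    rw [G_succ, G_succ, ← ih _ _ (fun i hi => h i (by omega)), e, p_mul j g _ (h j le_rfl),
      mul_add, mul_left_comm g _ f]

theorem G_K (lam : ℕ → ℕ) (hlam : Antitone lam) (N d j : ℕ) (hN : N = j + d + 1) (f : A)
    (hf : K N (j+1) (lam (j+1)) f) : K N N 0 (G lam d j f) := by
  induction d generalizing j f with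
  | zero =>
    rw [G_zero]
    have : N = j + 1 := by omega
    subst this
    exact K_zpow (K_weaken (Nat.zero_le _) hf)
  | succ d ih =>
    rw [G_succ]
    have e : j + d + 2 = N := by omega
    rw [e]
    have hl : lam (j+2) ≤ lam (j+1) := hlam (by omega)
    refine ih (j+1) (by omega) _ (K.add _ _ ?_ (K.pi _ _ (by omega) ?_))
    · exact K_E (show lam (j+2) + (lam (j+1) - lam (j+2)) ≤ lam (j+1) by omega) hf
    · exact K_X hl le_rfl hf

/-- the tail monomial `∏_{j < i ≤ j+d} X i ^ lam i` -/
noncomputable def tl (lam : ℕ → ℕ) : ℕ → ℕ → A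
  | 0, _ => 1
  | d+1, j => X (j+1) ^ lam (j+1) * tl lam d (j+1)

theorem s_tl (lam : ℕ → ℕ) (d j i : ℕ) (h : i < j) : s i (tl lam d j) = tl lam d j := by
  induction d generalizing j with
  | zero => simp [tl]
  | succ d ih =>
    simp only [tl, map_mul, map_pow]
    rw [ih _ (by omega), s_X3 _ _ (by omega) (by omega)]

theorem branch (lam : ℕ → ℕ) (hlam : Antitone lam) (d j a : ℕ) :
    c (d+1) j (X j ^ (lam (j+1) + a) * tl lam (d+1) j) =
      G lam d j (X j ^ lam (j+1) * E a (X j) (X (j+d+1))) := by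
  induction d generalizing j a with
  | zero =>
    rw [c_succ, c_zero, tl, tl, G_zero, mul_one]
    rw [p_XX]
    have hs : E a (X (j+1)) (X j) = E a (X j) (X (j+1)) := by
      apply mul_left_cancel₀ (D_ne (by omega : j ≠ j + 1))
      linear_combination -E_spec a (X (j+1)) (X j) - E_spec a (X j) (X (j+1))
    rw [hs]; ring
  | succ d ih =>
    have hl : lam (j+2) ≤ lam (j+1) := hlam (by omega)
    obtain ⟨b, hb⟩ := Nat.exists_eq_add_of_le hl
    have inv1 : ∀ i, j + 1 ≤ i → s i (X j) = X j :=
      fun i hi => s_X3 _ _ (by omega) (by omega)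
    have inner : ∀ a, c (d+1) (j+1) ((X j * X (j+1)) ^ lam (j+1) * E a (X (j+1)) (X j)
          * tl lam (d+1) (j+1)) =
        X j ^ lam (j+1) * G lam d (j+1) (X (j+1) ^ lam (j+2) *
          Phi b (X j) (X (j+1)) (X (j+d+2)) a) := by
      have base : ∀ e, c (d+1) (j+1) (X (j+1) ^ (lam (j+1) + e) * tl lam (d+1) (j+1)) =
          G lam d (j+1) (X (j+1) ^ lam (j+2) * E (b+e) (X (j+1)) (X (j+d+2))) := by
        intro e
        have := ih (j+1) (b+e)
        rw [show j + 1 + d + 1 = j + d + 2 by omega, show j + 1 + 1 = j + 2 from rfl] at this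
        rw [← this, hb, add_assoc]
      intro a
      induction a with
      | zero =>
        simp only [E, Phi, mul_one]
        rw [mul_pow, mul_assoc, c_mul _ _ _ _ (fun i hi => by rw [map_pow, inv1 i hi])]
        have := base 0
        rw [add_zero, add_zero] at this
        rw [this]
      | succ a iha =>
        have e1 : (X j * X (j+1)) ^ lam (j+1) * E (a+1) (X (j+1)) (X j) * tl lam (d+1) (j+1) =
          X j * ((X j * X (j+1)) ^ lam (j+1) * E a (X (j+1)) (X j) * tl lam (d+1) (j+1))
          + (X j ^ lam (j+1) * (1 + bt * X j)) *
            (X (j+1) ^ (lam (j+1) + (a+1)) * tl lam (d+1) (j+1)) := by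
          simp only [E]; ring
        rw [e1, c_add, c_mul _ _ _ _ inv1, iha, c_mul, base]
        · have e2 : X (j+1) ^ lam (j+2) * Phi b (X j) (X (j+1)) (X (j+d+2)) (a+1) =
            X j * (X (j+1) ^ lam (j+2) * Phi b (X j) (X (j+1)) (X (j+d+2)) a)
            + (1 + bt * X j) * (X (j+1) ^ lam (j+2) * E (b+(a+1)) (X (j+1)) (X (j+d+2))) := by
            simp only [Phi, ← add_assoc]; ring
          rw [e2, G_add, G_mul _ _ _ _ _ inv1,
            G_mul lam d (j+1) (1 + bt * X j) _ (fun i hi => by simp [inv1 i hi])]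
          ring
        · intro i hi
          simp [inv1 i hi]
    rw [c_succ, tl, ← mul_assoc, mul_comm _ (tl _ _ _), p_mul _ _ _ (s_tl _ _ _ _ (by omega)), p_XX,
      mul_comm (tl _ _ _), inner a, key _ _ _ _ (by omega), G_succ,
      ← G_mul _ _ _ _ _ (fun i hi => by rw [map_pow, inv1 i hi])]
    congr 1
    have e3 : X (j+1) ^ lam (j+1) * (X j ^ lam (j+1) * E a (X j) (X (j + (d + 1) + 1))) =
      (X j * X (j+1)) ^ lam (j+1) * E a (X j) (X (j + d + 2)) := by
      rw [show j + (d + 1) + 1 = j + d + 2 by omega]; ring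
    rw [e3, p_mul _ _ _ (by simp [mul_comm]), show lam (j+1) - lam (j+2) = b by omega,
      show j + (d + 1) + 1 = j + d + 2 by omega, hb]
    ring

theorem mono_split (μ : ℕ → ℕ) (d j : ℕ) :
    mono (j+d+1) μ = mono j μ * (X j ^ μ j * tl μ d j) := by
  induction d generalizing j with
  | zero => simp [tl, mono, Finset.prod_range_succ]
  | succ d ih =>
    rw [show j + (d+1) + 1 = (j+1) + d + 1 by omega, ih]
    simp only [tl, mono, Finset.prod_range_succ]
    ring

theorem s_mono (μ : ℕ → ℕ) (k i : ℕ) (h : k ≤ i) : s i (mono k μ) = mono k μ := by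
  unfold mono
  rw [map_prod]
  apply Finset.prod_congr rfl
  intro t ht
  have := Finset.mem_range.1 ht
  rw [map_pow, s_X3 _ _ (by omega) (by omega)]

theorem c_K (lam : ℕ → ℕ) (hlam : Antitone lam) (N d j : ℕ) (hN : j + d = N) :
    K N N 0 (c d j (mono (N+1) lam)) := by
  cases d with
  | zero =>
    subst hN
    rw [c_zero]
    have := mono_split lam 0 j
    simp only [tl, mul_one] at this
    rw [add_zero] at this ⊢
    rw [this, mul_comm]
    exact K_zpow (K.mono _ (fun i _ => hlam (by omega)) (fun i _ => Nat.zero_le _))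
  | succ d =>
    subst hN
    rw [mono_split, c_mul _ _ _ _ (fun i hi => s_mono _ _ _ hi)]
    have hl : lam (j+1) ≤ lam j := hlam (by omega)
    obtain ⟨a, ha⟩ := Nat.exists_eq_add_of_le hl
    rw [ha, branch lam hlam, ← G_mul _ _ _ _ _ (fun i hi => s_mono _ _ _ hi)]
    apply G_K lam hlam _ _ _ (by omega)
    have hm : K (j + (d+1)) j (lam (j+1) + a) (mono j lam) :=
      K.mono _ (fun i _ => hlam (by omega)) (fun i hi => ha ▸ hlam (by omega))
    have e : mono j lam * (X j ^ lam (j+1) * E a (X j) (X (j+d+1))) =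
      X j ^ lam (j+1) * (E a (X j) (X (j+d+1)) - X j ^ a) * mono j lam
      + X j ^ (lam (j+1) + a) * mono j lam := by ring
    rw [e]
    exact K.add _ _ (K_E le_rfl hm) (K_X (by omega) le_rfl hm)

theorem pos_all (k : ℕ) : Pos k := by
  induction k with
  | zero =>
    intro μ _ l hl
    cases l with
    | nil => simp [mono, NN.one_mem]
    | cons i l => exact absurd (hl i (by simp)) (by omega)
  | succ N ih =>
    intro μ hμ l hl
    have hanti : Antitone (fun i => μ (min i N)) := by
      apply antitone_nat_of_succ_le
      intro i
      rcases Nat.lt_or_ge i N with h | h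
      · rw [min_eq_left (by omega), min_eq_left (by omega)]
        exact hμ i (by omega)
      · rw [min_eq_right (by omega), min_eq_right (by omega)]
    have e : mono (N+1) μ = mono (N+1) (fun i => μ (min i N)) := by
      apply Finset.prod_congr rfl
      intro i hi
      have := Finset.mem_range.1 hi
      show (X i : A) ^ μ i = X i ^ μ (min i N)
      rw [min_eq_left (by omega)]
    obtain ⟨u, j, d, hu, hj, hf⟩ := normal_form N l (fun i hi => by have := hl i hi; omega)
    rw [hf, e]
    exact K_good le_rfl ih (c_K _ hanti N d j hj) u hu

/-! ### Transfer to finitely many variables -/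

theorem ddiff_spec {n : ℕ} {R : Type} [CommRing R] (i j : Fin n) (f : MvPolynomial (Fin n) R) :
    (X i - X j) * ddiff i j f = f - rename (Equiv.swap i j) f := by
  have h := dvd_sub_swap i j f
  unfold ddiff
  rw [dif_pos h]
  exact h.choose_spec.symm

noncomputable def io (m : ℕ) : MvPolynomial (Fin (m+1)) (Polynomial ℤ) →ₐ[Polynomial ℤ] A :=
  rename Fin.val

theorem io_swap {m : ℕ} (i : Fin m) (f : MvPolynomial (Fin (m+1)) (Polynomial ℤ)) :
    io m (rename (Equiv.swap i.castSucc i.succ) f) = s i (io m f) := by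
  simp only [io, s, rename_rename]
  congr 2
  funext k
  simp only [Function.comp, Equiv.swap_apply_def, Fin.ext_iff]
  split_ifs <;> simp_all

theorem io_piOp {m : ℕ} (i : Fin m) (f : MvPolynomial (Fin (m+1)) (Polynomial ℤ)) :
    io m (piOp i f) = p i (io m f) := by
  symm
  apply p_uniq
  have h := congrArg (io m) (ddiff_spec i.castSucc i.succ
    (X i.castSucc * f + C Polynomial.X * (X i.castSucc * (X i.succ * f))))
  rw [map_sub (io m), io_swap] at h
  have e1 : io m (X i.castSucc) = X (i : ℕ) := by simp [io]
  have e2 : io m (X i.succ) = X ((i : ℕ) + 1) := by simp [io]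
  have e3 : io m (C Polynomial.X) = bt := by simp [io, bt]
  simp only [map_mul, map_add, map_sub, e1, e2, e3, s_bt, s_X1, s_X2] at h
  unfold piOp
  linear_combination h

theorem io_piWord {m : ℕ} (l : List (Fin m)) (f : MvPolynomial (Fin (m+1)) (Polynomial ℤ)) :
    io m (piWord l f) = Wd (l.map Fin.val) (io m f) := by
  induction l generalizing f with
  | nil => rfl
  | cons i l ih =>
    rw [List.map_cons, Wd_cons, ← io_piOp, ← ih]
    rfl

theorem main (m : ℕ) (lam : Fin (m+1) → ℕ) (hlam : Antitone lam) (l : List (Fin m))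
    (mo : Fin (m+1) →₀ ℕ) (d : ℕ) :
    0 ≤ (MvPolynomial.coeff mo
        (piWord l (∏ i, (X i : MvPolynomial (Fin (m+1)) (Polynomial ℤ)) ^ lam i))).coeff d := by
  rw [← coeff_rename_mapDomain Fin.val Fin.val_injective]
  apply NN_coeff
  change io m _ ∈ NN
  rw [io_piWord]
  have e : io m (∏ i, (X i : MvPolynomial (Fin (m+1)) (Polynomial ℤ)) ^ lam i) =
      mono (m+1) (fun i => if h : i < m+1 then lam ⟨i, h⟩ else 0) := by
    unfold mono
    rw [Finset.prod_range, map_prod]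
    apply Finset.prod_congr rfl
    intro i _
    simp only [io, map_pow, rename_X]
    rw [dif_pos i.2]
  rw [e]
  apply pos_all
  · intro i hi
    rw [dif_pos hi, dif_pos (by omega)]
    exact hlam (by simp [Fin.le_def])
  · intro i hi
    obtain ⟨k, _, rfl⟩ := List.mem_map.1 hi
    have := k.2
    omega

end Lsc

/-- Every Lascoux polynomial `L_{w,λ}` (computed from a reduced word
`l` of `w`) has nonnegative integer coefficients as a polynomial in
`ℤ[β][x_1,…,x_n]`. -/
theorem lascoux_nonneg_coeffs (m : ℕ) (lam : Fin (m+1) → ℕ) (hlam : Antitone lam)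
    (w : Equiv.Perm (Fin (m+1))) (l : List (Fin m)) (hl : IsReducedWord l w)
    (mo : Fin (m+1) →₀ ℕ) (d : ℕ) :
    0 ≤ (MvPolynomial.coeff mo
        (piWord l (∏ i, (X i : MvPolynomial (Fin (m+1)) (Polynomial ℤ)) ^ lam i))).coeff d := by
  exact Lsc.main m lam hlam l mo d
end

section
/- For permutations u ≤ w in the Bruhat order on S_n and any partition λ, the difference of Lascoux polynomials L_{w,λ} − L_{u,λ} has nonnegative coefficients. -/
open MvPolynomial
/-- Bruhat order on the symmetric group, via the subword property: `u ≤ w` iff some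
reduced word of `w` contains a reduced word of `u` as a subword. -/
def BruhatLE {m : ℕ} (u w : Equiv.Perm (Fin (m+1))) : Prop :=
  ∃ (lw lu : List (Fin m)), IsReducedWord lw w ∧ IsReducedWord lu u ∧ lu.Sublist lw

namespace LB
variable {R : Type*} [CommRing R]

/-- one vertex -/
def step (b x : R) (a t : ℕ) (φ : ℕ → ℕ → R) : R :=
  if t = 0 ∧ a ≠ 0 then x * φ 0 a + (1 + b * x) * φ a 0 else φ (min a t) (max a t)

def rmat (b x y : R) (φ : ℕ → ℕ → R) (c d : ℕ) : R :=
  if d ≤ c then y * (1 + b * x) * φ c d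
  else if c = 0 then y * (1 + b * y) * φ c d - y * (x - y) * φ d c
  else x * (1 + b * y) * φ c d - (x - y) * φ d c

theorem local_ybe (b x y : R) (t : ℕ) (φ : ℕ → ℕ → ℕ → R) (a c : ℕ) :
    rmat b x y (fun a c => step b y a t (fun e a' => step b x c e (fun f c' => φ f a' c'))) a c
    = step b x a t (fun e a' => step b y c e (fun f c' => rmat b x y (φ f) a' c')) := by
  rcases Nat.eq_zero_or_pos a with ha | ha <;> rcases Nat.eq_zero_or_pos c with hc | hc <;>
  rcases Nat.eq_zero_or_pos t with ht | ht <;> 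
  rcases lt_trichotomy a c with h1 | h1 | h1 <;>
  rcases lt_trichotomy a t with h2 | h2 | h2 <;>
  rcases lt_trichotomy c t with h3 | h3 | h3 <;>
  first
  | (exfalso; omega)
  | (subst_vars
     simp_all [step, rmat, ne_of_gt, not_le_of_gt, le_of_lt]
     try ring)

def rowOp (b x : R) : ℕ → List ℕ → (List ℕ → ℕ → R) → R
  | a, [], Q => Q [] a
  | a, t :: ts, Q => step b x a t (fun e a' => rowOp b x a' ts (fun l c => Q (e :: l) c))

theorem rowOp_lin (b x u v : R) (ts : List ℕ) : ∀ (a : ℕ) (Q P : List ℕ → ℕ → R),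
    rowOp b x a ts (fun l c => u * Q l c + v * P l c) = u * rowOp b x a ts Q + v * rowOp b x a ts P := by
  induction ts with
  | nil => intros; rfl
  | cons t ts ih =>
    intro a Q P
    simp only [rowOp, step, ih]
    split_ifs <;> ring

theorem rowOp_step (b x y : R) (a c e : ℕ) (ts : List ℕ) (G : List ℕ → ℕ → ℕ → ℕ → R) :
    rowOp b x a ts (fun l d => step b y c e (fun f c' => G l d f c'))
     = step b y c e (fun f c' => rowOp b x a ts (fun l d => G l d f c')) := by
  simp only [step]
  split_ifs
  · rw [rowOp_lin]
  · rfl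

def two (b x y : R) (ts : List ℕ) (Q : List ℕ → ℕ → ℕ → R) (a c : ℕ) : R :=
  rowOp b x a ts (fun e a' => rowOp b y c e (fun f c' => Q f a' c'))

theorem two_cons (b x y : R) (t : ℕ) (ts : List ℕ) (Q : List ℕ → ℕ → ℕ → R) (a c : ℕ) :
    two b x y (t :: ts) Q a c = step b x a t (fun e a' => step b y c e (fun f c' =>
      two b x y ts (fun l => Q (f :: l)) a' c')) := by
  simp only [two, rowOp, rowOp_step]

theorem ybe (b x y : R) (ts : List ℕ) : ∀ (Q : List ℕ → ℕ → ℕ → R) (a c : ℕ),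
    rmat b x y (two b y x ts Q) a c = two b x y ts (fun l => rmat b x y (Q l)) a c := by
  induction ts with
  | nil => intros; rfl
  | cons t ts ih =>
    intro Q a c
    have h1 : two b y x (t :: ts) Q = fun a c => step b y a t (fun e a' => step b x c e (fun f c' =>
      two b y x ts (fun l => Q (f :: l)) a' c')) := by
      funext a c; rw [two_cons]
    rw [h1, local_ybe, two_cons]
    simp only [ih]


/-- partition function -/
def zfun (b : R) : List (R × ℕ) → List ℕ → R
  | [], _ => 1
  | r :: rs, top => rowOp b r.1 0 top (fun e a => if a = r.2 then zfun b rs e else 0)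

theorem rowOp_zero (b x : R) (ts : List ℕ) (a : ℕ) : rowOp b x a ts (fun _ _ => 0) = 0 := by
  have := rowOp_lin b x 0 0 ts a (fun _ _ => 0) (fun _ _ => 0)
  simpa using this

theorem two_lin (b x y u v : R) (ts : List ℕ) (a c : ℕ) (Q P : List ℕ → ℕ → ℕ → R) :
    two b x y ts (fun l c d => u * Q l c d + v * P l c d) a c
      = u * two b x y ts Q a c + v * two b x y ts P a c := by
  simp only [two, rowOp_lin]

theorem zfun_two (b x y : R) (c d : ℕ) (rs : List (R × ℕ)) (top : List ℕ) :
    zfun b ((x, c) :: (y, d) :: rs) top =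
      two b x y top (fun l p q => if p = c ∧ q = d then zfun b rs l else 0) 0 0 := by
  simp only [zfun, two]
  congr 1
  funext e a
  by_cases h : a = c
  · simp [h]
  · simp [h, rowOp_zero]

theorem zfun_swap (b x y : R) (c d : ℕ) (hd : 0 < d) (hcd : d < c) (rs : List (R × ℕ))
    (top : List ℕ) :
    (x - y) * zfun b ((x, d) :: (y, c) :: rs) top =
      y * (1 + b * x) * (zfun b ((x, c) :: (y, d) :: rs) top
        - zfun b ((y, c) :: (x, d) :: rs) top) := by
  have h := ybe b x y top (fun l p q => if p = c ∧ q = d then zfun b rs l else 0) 0 0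
  have h2 : (fun l => rmat b x y (fun p q => if p = c ∧ q = d then zfun b rs l else 0)) =
      fun l p q => (y * (1 + b * x)) * (if p = c ∧ q = d then zfun b rs l else 0) +
        (-(x - y)) * (if p = d ∧ q = c then zfun b rs l else 0) := by
    funext l p q
    simp only [rmat]
    by_cases h1 : p = c ∧ q = d
    · obtain ⟨rfl, rfl⟩ := h1
      have : ¬ (p = q ∧ q = p) := by omega
      simp [hcd.le, this]
    · by_cases h2 : p = d ∧ q = c
      · obtain ⟨rfl, rfl⟩ := h2
        have e1 : ¬ (p = q ∧ q = p) := by omega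
        simp [not_le.2 hcd, e1, hd.ne']
        try ring
      · have h3 : ¬ (q = c ∧ p = d) := by tauto
        simp [h1, h2, h3]
  rw [h2, two_lin, ← zfun_two, ← zfun_two] at h
  simp only [rmat, le_refl, if_true] at h
  rw [← zfun_two] at h
  linear_combination h

theorem zfun_ofFn_swap (b : R) (x y : R) (c d : ℕ) (hd : 0 < d) (hcd : d < c) :
    ∀ (m : ℕ) (i : Fin m) (F G H : Fin (m+1) → R × ℕ) (top : List ℕ),
    (∀ j, j ≠ i.castSucc → j ≠ i.succ → G j = F j ∧ H j = F j) →
    F i.castSucc = (x, c) → F i.succ = (y, d) →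
    G i.castSucc = (x, d) → G i.succ = (y, c) →
    H i.castSucc = (y, c) → H i.succ = (x, d) →
    (x - y) * zfun b (List.ofFn G) top =
      y * (1 + b * x) * (zfun b (List.ofFn F) top - zfun b (List.ofFn H) top) := by
  intro m
  induction m with
  | zero => intro i; exact i.elim0
  | succ m ih =>
    intro i F G H top hoff hF1 hF2 hG1 hG2 hH1 hH2
    induction i using Fin.cases with
    | zero =>
      rw [List.ofFn_succ, List.ofFn_succ, List.ofFn_succ (f := F), List.ofFn_succ,
        List.ofFn_succ (f := H), List.ofFn_succ]
      have e1 : (fun j : Fin m => G j.succ.succ) = fun j => F j.succ.succ := by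
        funext j
        exact (hoff _ (by simp [Fin.ext_iff]) (by simp [Fin.ext_iff])).1
      have e2 : (fun j : Fin m => H j.succ.succ) = fun j => F j.succ.succ := by
        funext j
        exact (hoff _ (by simp [Fin.ext_iff]) (by simp [Fin.ext_iff])).2
      simp only [Fin.castSucc_zero] at hF1 hG1 hH1
      rw [e1, e2, hF1, hF2, hG1, hG2, hH1, hH2]
      exact zfun_swap b x y c d hd hcd _ _
    | succ i =>
      rw [List.ofFn_succ, List.ofFn_succ (f := F), List.ofFn_succ (f := H)]
      obtain ⟨g0, h0⟩ := hoff 0 (by simp [Fin.ext_iff]) (by simp [Fin.ext_iff])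
      rw [g0, h0]
      simp only [zfun]
      have key : ∀ top', (x - y) * zfun b (List.ofFn fun j => G j.succ) top' =
          y * (1 + b * x) * (zfun b (List.ofFn fun j => F j.succ) top'
            - zfun b (List.ofFn fun j => H j.succ) top') := by
        intro top'
        apply ih i (fun j => F j.succ) (fun j => G j.succ) (fun j => H j.succ) top'
        · intro j h1 h2
          apply hoff
          · simpa [Fin.ext_iff] using h1
          · simpa [Fin.ext_iff] using h2
        · simpa using hF1
        · exact hF2
        · simpa using hG1
        · exact hG2
        · simpa using hH1
        · exact hH2
      have l1 := rowOp_lin b (F 0).1 (x - y) 0 top 0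
        (fun e a => if a = (F 0).2 then zfun b (List.ofFn fun j => G j.succ) e else 0) (fun _ _ => 0)
      have l2 := rowOp_lin b (F 0).1 (y * (1 + b * x)) (-(y * (1 + b * x))) top 0
        (fun e a => if a = (F 0).2 then zfun b (List.ofFn fun j => F j.succ) e else 0)
        (fun e a => if a = (F 0).2 then zfun b (List.ofFn fun j => H j.succ) e else 0)
      have l3 : rowOp b (F 0).1 0 top (fun e a => (x - y) *
        (if a = (F 0).2 then zfun b (List.ofFn fun j => G j.succ) e else 0) + 0 * 0) =
        rowOp b (F 0).1 0 top (fun e a => (y * (1 + b * x)) *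
        (if a = (F 0).2 then zfun b (List.ofFn fun j => F j.succ) e else 0)
         + (-(y * (1 + b * x))) *
        (if a = (F 0).2 then zfun b (List.ofFn fun j => H j.succ) e else 0)) := by
        congr 1
        funext e a
        split_ifs
        · linear_combination key e
        · ring
      rw [l1, l2] at l3
      linear_combination l3

theorem rowOp_map {S : Type*} [CommRing S] (f : R →+* S) (b x : R) (ts : List ℕ) :
    ∀ (a : ℕ) (Q : List ℕ → ℕ → R),
    f (rowOp b x a ts Q) = rowOp (f b) (f x) a ts (fun l c => f (Q l c)) := by
  induction ts with
  | nil => intros; rfl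
  | cons t ts ih =>
    intro a Q
    simp only [rowOp, step]
    split_ifs <;> simp [ih]

theorem zfun_map {S : Type*} [CommRing S] (f : R →+* S) (b : R) (rs : List (R × ℕ)) :
    ∀ top, f (zfun b rs top) = zfun (f b) (rs.map (fun r => (f r.1, r.2))) top := by
  induction rs with
  | nil => intro top; simp [zfun]
  | cons r rs ih =>
    intro top
    simp only [zfun, List.map_cons, rowOp_map, apply_ite f, ih, map_zero]

/-! base case -/
theorem rowOp_small (b x : R) (A : ℕ) (P : List ℕ → R) (ts : List ℕ) (hts : ∀ t ∈ ts, t < A) :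
    ∀ (a : ℕ) (f : List ℕ → List ℕ), a < A →
      rowOp b x a ts (fun l c => if c = A then P (f l) else 0) = 0 := by
  induction ts with
  | nil => intro a f h; simp [rowOp, h.ne]
  | cons t ts ih =>
    intro a f h
    have ht := hts t (by simp)
    have ih' := ih (fun t h => hts t (by simp [h]))
    simp only [rowOp, step]
    split_ifs
    · rw [ih' a (fun l => f (0 :: l)) h, ih' 0 (fun l => f (a :: l)) (by omega)]; simp
    · exact ih' _ (fun l => f (_ :: l)) (by omega)

theorem rowOp_big (b x : R) (A : ℕ) (hA : 0 < A) (P : List ℕ → R) (ts : List ℕ)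
    (hts : ∀ t ∈ ts, t < A) :
    ∀ (f : List ℕ → List ℕ),
      rowOp b x A ts (fun l c => if c = A then P (f l) else 0) = x ^ (ts.count 0) * P (f ts) := by
  induction ts with
  | nil => intro f; simp [rowOp]
  | cons t ts ih =>
    intro f
    have ht := hts t (by simp)
    have hts' : ∀ t ∈ ts, t < A := (fun t h => hts t (by simp [h]))
    have ih' := ih hts'
    simp only [rowOp, step]
    by_cases h0 : t = 0
    · subst h0
      rw [if_pos ⟨rfl, hA.ne'⟩, ih' (fun l => f (0 :: l)),
        rowOp_small b x A P ts hts' 0 (fun l => f (A :: l)) hA]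
      simp [pow_succ]; ring
    · rw [if_neg (by tauto), min_eq_right ht.le, max_eq_left ht.le, ih' (fun l => f (t :: l))]
      simp [h0]

theorem rowOp_rep (b x : R) (k : ℕ) (ts : List ℕ) : ∀ (Q : List ℕ → ℕ → R),
    rowOp b x 0 (List.replicate k 0 ++ ts) Q =
      rowOp b x 0 ts (fun l c => Q (List.replicate k 0 ++ l) c) := by
  induction k with
  | zero => intro Q; simp
  | succ k ih => intro Q; simp [List.replicate_succ, rowOp, step, ih]

def topL : List ℕ → List ℕ
  | [] => []
  | p :: q => (q.length + 1) :: (List.replicate (p - q.headD 0) 0 ++ topL q)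

theorem topL_lt (q : List ℕ) : ∀ t ∈ topL q, t < q.length + 1 := by
  induction q with
  | nil => simp [topL]
  | cons p q ih =>
    intro t ht
    simp only [topL, List.mem_cons, List.mem_append, List.mem_replicate] at ht
    simp only [List.length_cons]
    rcases ht with h | h | h
    · omega
    · omega
    · have := ih t h; omega

theorem topL_count (q : List ℕ) (hq : q.SortedGE) : (topL q).count 0 = q.headD 0 := by
  induction q with
  | nil => simp [topL]
  | cons p q ih =>
    have hq' := hq.pairwise
    rw [List.pairwise_cons] at hq'
    simp only [topL, List.count_cons, List.count_append, List.count_replicate, ih hq'.2.sortedGE]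
    cases q with
    | nil => simp
    | cons r q => have := hq'.1 r (by simp); simp; omega

theorem zfun_base (b : R) : ∀ (n k : ℕ) (x : Fin n → R) (lam : Fin n → ℕ), Antitone lam →
    zfun b (List.ofFn fun j : Fin n => (x j, n - (j : ℕ)))
      (List.replicate k 0 ++ topL (List.ofFn lam)) = ∏ j, x j ^ lam j := by
  intro n
  induction n with
  | zero => intro k x lam _; simp [zfun]
  | succ n ih =>
    intro k x lam hl
    have hs : (List.ofFn lam).SortedGE := List.sortedGE_ofFn_iff.2 hl
    have hc := topL_count _ hs
    have hl' : Antitone (fun j : Fin n => lam j.succ) :=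
      fun i j hij => hl (Fin.succ_le_succ_iff.2 hij)
    rw [List.ofFn_succ] at hc ⊢
    rw [List.ofFn_succ (f := lam)]
    simp only [zfun, rowOp_rep]
    simp only [topL, rowOp, step, List.length_ofFn]
    rw [if_neg (by simp)]
    simp only [zero_le, max_eq_right, min_eq_left, Fin.val_zero, Nat.sub_zero]
    have hlt := topL_lt (List.ofFn fun j : Fin n => lam j.succ)
    rw [List.length_ofFn] at hlt
    have := rowOp_big b (x 0) (n+1) (by omega)
      (zfun b (List.ofFn fun j : Fin n => (x j.succ, n + 1 - (j.succ : ℕ))))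
      (List.replicate (lam 0 - (List.ofFn fun j : Fin n => lam j.succ).headD 0) 0 ++
        topL (List.ofFn fun j : Fin n => lam j.succ)) (by
          intro t ht
          rw [List.mem_append, List.mem_replicate] at ht
          rcases ht with h | h
          · omega
          · exact hlt t h) (fun l => List.replicate k 0 ++ 0 :: l)
    rw [this]
    have e : ∀ (K : ℕ) (l : List ℕ), List.replicate k 0 ++ 0 :: (List.replicate K 0 ++ l)
        = List.replicate (k + 1 + K) 0 ++ l := by
      intro K l
      rw [List.replicate_add, List.replicate_add]; simp
    rw [e]
    have e2 : (fun j : Fin n => (x j.succ, n + 1 - (j.succ : ℕ))) =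
        fun j : Fin n => (x j.succ, n - (j : ℕ)) := by
      funext j; simp
    rw [e2, ih _ _ _ hl', Fin.prod_univ_succ]
    simp only [topL, List.count_cons, List.length_ofFn] at hc
    have hc2 : List.count 0 (List.replicate (lam 0 - (List.ofFn fun j : Fin n => lam j.succ).headD 0) 0 ++
        topL (List.ofFn fun j : Fin n => lam j.succ)) = lam 0 := by simpa using hc
    rw [hc2]

/-! positivity -/
theorem rowOp_mem (S : Subsemiring R) (b x : R) (hb : b ∈ S) (hx : x ∈ S) (ts : List ℕ) :
    ∀ (a : ℕ) (Q : List ℕ → ℕ → R), (∀ l c, Q l c ∈ S) → rowOp b x a ts Q ∈ S := by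
  induction ts with
  | nil => intro a Q h; exact h _ _
  | cons t ts ih =>
    intro a Q h
    simp only [rowOp, step]
    split_ifs
    · exact add_mem (mul_mem hx (ih _ _ fun _ _ => h _ _))
        (mul_mem (add_mem (one_mem _) (mul_mem hb hx)) (ih _ _ fun _ _ => h _ _))
    · exact ih _ _ fun _ _ => h _ _

theorem zfun_mem (S : Subsemiring R) (b : R) (hb : b ∈ S) (rs : List (R × ℕ))
    (hrs : ∀ r ∈ rs, r.1 ∈ S) : ∀ top, zfun b rs top ∈ S := by
  induction rs with
  | nil => intro top; exact one_mem _
  | cons r rs ih =>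
    intro top
    simp only [zfun]
    apply rowOp_mem S b _ hb (hrs r (by simp))
    intro l c
    split_ifs
    · exact ih (fun r h => hrs r (by simp [h])) l
    · exact zero_mem _

end LB

namespace LB
open Equiv

theorem toSwap_mul_self {m : ℕ} (i : Fin m) : toSwap i * toSwap i = 1 := by
  simp [toSwap]

/-- strong exchange -/
theorem exchange {m : ℕ} (l : List (Fin m)) : ∀ (a b : Fin (m+1)), a < b →
    (l.map toSwap).prod b < (l.map toSwap).prod a →
    ∃ l' : List (Fin m), l'.Sublist l ∧ l'.length < l.length ∧
      (l'.map toSwap).prod = (l.map toSwap).prod * swap a b := by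
  induction l with
  | nil => intro a b h1 h2; simp at h2; exact absurd h1 (not_lt.2 h2.le)
  | cons i l ih =>
    intro a b h1 h2
    simp only [List.map_cons, List.prod_cons, Perm.mul_apply] at h2 ⊢
    set r := (l.map toSwap).prod with hr
    by_cases h : r b < r a
    · obtain ⟨l', hl, hlen, hp⟩ := ih a b h1 h
      refine ⟨i :: l', hl.cons_cons i, by simpa using hlen, ?_⟩
      simp [hp, mul_assoc]
    · have hne : r a ≠ r b := fun h => h1.ne (r.injective h)
      have hlt : r a < r b := lt_of_le_of_ne (not_lt.1 h) hne
      have key : r a = i.castSucc ∧ r b = i.succ := by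
        generalize r a = p at *
        generalize r b = q at *
        simp only [toSwap, swap_apply_def] at h2
        simp only [Fin.ext_iff, Fin.lt_def] at *
        split_ifs at h2 <;> simp_all [Fin.ext_iff] <;> omega
      refine ⟨l, List.sublist_cons_self _ _, by simp, ?_⟩
      rw [toSwap, ← key.1, ← key.2, Equiv.swap_apply_apply, ← hr]
      simp [mul_assoc]

/-- one Bruhat step down: `v = w * (a b)`. -/
def Down {m : ℕ} (w v : Perm (Fin (m+1))) : Prop :=
  ∃ a b, a < b ∧ w b < w a ∧ v = w * swap a b

def Sub {m : ℕ} (l : List (Fin m)) (v : Perm (Fin (m+1))) : Prop :=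
  ∃ l' : List (Fin m), l'.Sublist l ∧ (l'.map toSwap).prod = v

theorem Sub.down {m : ℕ} {l : List (Fin m)} {w v : Perm (Fin (m+1))} (h : Sub l w)
    (hd : Down w v) : Sub l v := by
  obtain ⟨l', hl, rfl⟩ := h
  obtain ⟨a, b, hab, hw, rfl⟩ := hd
  obtain ⟨l2, h2, -, h3⟩ := exchange l' a b hab hw
  exact ⟨l2, h2.trans hl, h3⟩

theorem Sub.downs {m : ℕ} {l : List (Fin m)} {w v : Perm (Fin (m+1))} (h : Sub l w)
    (hd : Relation.ReflTransGen Down w v) : Sub l v := by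
  induction hd with
  | refl => exact h
  | tail _ h2 ih => exact ih.down h2

theorem sub_append {m : ℕ} (l : List (Fin m)) (i : Fin m) (v : Perm (Fin (m+1))) :
    Sub (l ++ [i]) v ↔ Sub l v ∨ Sub l (v * toSwap i) := by
  constructor
  · rintro ⟨l', hl, rfl⟩
    rw [List.sublist_append_iff] at hl
    obtain ⟨l1, l2, rfl, h1, h2⟩ := hl
    rcases List.sublist_singleton.1 h2 with rfl | rfl
    · left; exact ⟨l1, h1, by simp⟩
    · right; exact ⟨l1, h1, by simp [mul_assoc, toSwap_mul_self]⟩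
  · rintro (⟨l', hl, h⟩ | ⟨l', hl, h⟩)
    · exact ⟨l', hl.trans (List.sublist_append_left _ _), h⟩
    · refine ⟨l' ++ [i], hl.append (List.Sublist.refl _), ?_⟩
      simp [h, mul_assoc, toSwap_mul_self]

theorem down_lift {m : ℕ} (i : Fin m) (w v : Perm (Fin (m+1))) (h : Down w v) :
    Down (w * toSwap i) (v * toSwap i) ∨ v * toSwap i = w := by
  obtain ⟨a, b, hab, hw, rfl⟩ := h
  by_cases hs : a = i.castSucc ∧ b = i.succ
  · right
    obtain ⟨rfl, rfl⟩ := hs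
    simp [toSwap, mul_assoc]
  · left
    refine ⟨toSwap i a, toSwap i b, ?_, ?_, ?_⟩
    · simp only [toSwap, swap_apply_def]
      simp only [Fin.ext_iff, Fin.lt_def] at *
      split_ifs <;> simp_all <;> omega
    · simpa [toSwap] using hw
    · rw [Equiv.swap_apply_apply]
      simp [mul_assoc, toSwap]

theorem le_lift {m : ℕ} (i : Fin m) (w v : Perm (Fin (m+1)))
    (h : Relation.ReflTransGen Down w v) :
    Relation.ReflTransGen Down (w * toSwap i) (v * toSwap i) ∨
    Relation.ReflTransGen Down w (v * toSwap i) := by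
  induction h with
  | refl => left; exact .refl
  | tail h1 h2 ih =>
    rcases down_lift i _ _ h2 with h | h
    · rcases ih with ih | ih
      · left; exact ih.tail h
      · right; exact ih.tail h
    · right; rw [h]; exact h1

theorem sub_le {m : ℕ} (l : List (Fin m)) : ∀ (w v : Perm (Fin (m+1))), IsReducedWord l w →
    Sub l v → Relation.ReflTransGen Down w v := by
  induction l using List.reverseRecOn with
  | nil =>
    rintro w v ⟨rfl, -⟩ ⟨l', hl, rfl⟩
    rw [List.sublist_nil.1 hl]
  | append_singleton l i ih =>
    rintro w v ⟨hw, hmin⟩ hv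
    set w0 := (l.map toSwap).prod with hw0
    have hww : w = w0 * toSwap i := by rw [← hw]; simp [hw0]
    have hred : IsReducedWord l w0 := by
      refine ⟨rfl, fun l2 h2 => ?_⟩
      have := hmin (l2 ++ [i]) (by simp [h2, hww])
      simpa using this
    have hasc : w0 i.castSucc < w0 i.succ := by
      rcases lt_trichotomy (w0 i.castSucc) (w0 i.succ) with h | h | h
      · exact h
      · exact absurd (w0.injective h) (by simp [Fin.ext_iff])
      · obtain ⟨l2, -, h2, h3⟩ := exchange l i.castSucc i.succ (Fin.castSucc_lt_succ) h
        have := hmin l2 (by rw [h3, hww]; rfl)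
        simp at this
        omega
    have hdown : Down w w0 := by
      refine ⟨i.castSucc, i.succ, Fin.castSucc_lt_succ, ?_, ?_⟩
      · simpa [hww, toSwap] using hasc
      · simp [hww, toSwap, mul_assoc]
    rcases (sub_append l i v).1 hv with h | h
    · exact Relation.ReflTransGen.head hdown (ih _ _ hred h)
    · have h1 := le_lift i _ _ (ih _ _ hred h)
      rw [mul_assoc, toSwap_mul_self, mul_one, ← hww] at h1
      rcases h1 with h1 | h1
      · exact h1
      · exact Relation.ReflTransGen.head hdown h1

theorem sub_iff {m : ℕ} (l : List (Fin m)) (w v : Perm (Fin (m+1))) (h : IsReducedWord l w) :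
    Sub l v ↔ Relation.ReflTransGen Down w v :=
  ⟨sub_le l w v h, fun hd => Sub.downs ⟨l, List.Sublist.refl _, h.1⟩ hd⟩

theorem sub_of_bruhat {m : ℕ} (u w : Perm (Fin (m+1))) (huw : BruhatLE u w)
    (lu lw : List (Fin m)) (hlu : IsReducedWord lu u) (hlw : IsReducedWord lw w)
    (v : Perm (Fin (m+1))) (hv : Sub lu v) : Sub lw v := by
  obtain ⟨lw', lu', h1, h2, h3⟩ := huw
  rw [sub_iff lw w v hlw]
  exact ((sub_iff lw' w u h1).1 ⟨lu', h3, h2.1⟩).trans ((sub_iff lu u v hlu).1 hv)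

end LB

namespace LB
open Equiv

abbrev MP (m : ℕ) := MvPolynomial (Fin (m+1)) (Polynomial ℤ)

/-- polynomials with nonnegative coefficients -/
def nn (m : ℕ) : Subsemiring (MP m) where
  carrier := {p | ∀ mo d, 0 ≤ (MvPolynomial.coeff mo p).coeff d}
  zero_mem' := by intro mo d; simp
  one_mem' := by
    intro mo d
    rw [MvPolynomial.coeff_one]
    split_ifs
    · rw [Polynomial.coeff_one]; split_ifs <;> simp
    · simp
  add_mem' := by
    intro p q hp hq mo d
    rw [MvPolynomial.coeff_add, Polynomial.coeff_add]
    exact add_nonneg (hp _ _) (hq _ _)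
  mul_mem' := by
    intro p q hp hq mo d
    rw [MvPolynomial.coeff_mul, Polynomial.finsetSum_coeff]
    refine Finset.sum_nonneg fun x _ => ?_
    rw [Polynomial.coeff_mul]
    exact Finset.sum_nonneg fun y _ => mul_nonneg (hp _ _) (hq _ _)

noncomputable def bb (m : ℕ) : MP m := C Polynomial.X

theorem X_mem (m : ℕ) (i : Fin (m+1)) : (X i : MP m) ∈ nn m := by
  intro mo d
  rw [MvPolynomial.coeff_X]
  split_ifs
  · rw [Polynomial.coeff_one]; split_ifs <;> simp
  · simp

theorem bb_mem (m : ℕ) : bb m ∈ nn m := by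
  intro mo d
  rw [bb, MvPolynomial.coeff_C]
  split_ifs
  · rw [Polynomial.coeff_X]; split_ifs <;> simp
  · simp

/-- Lascoux atoms as partition functions -/
noncomputable def atom {m : ℕ} (lam : Fin (m+1) → ℕ) (w : Perm (Fin (m+1))) : MP m :=
  zfun (bb m) (List.ofFn fun j => ((X j : MP m), m + 1 - (w j : ℕ))) (topL (List.ofFn lam))

theorem atom_mem {m : ℕ} (lam : Fin (m+1) → ℕ) (w : Perm (Fin (m+1))) : atom lam w ∈ nn m := by
  apply zfun_mem _ _ (bb_mem m)
  intro r hr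
  rw [List.mem_ofFn] at hr
  obtain ⟨j, rfl⟩ := hr
  exact X_mem m j

theorem atom_one {m : ℕ} (lam : Fin (m+1) → ℕ) (hl : Antitone lam) :
    atom lam 1 = ∏ i, (X i : MP m) ^ lam i := by
  have := zfun_base (bb m) (m+1) 0 (fun j => (X j : MP m)) lam hl
  simpa [atom] using this

noncomputable def sw {m : ℕ} (i : Fin m) : MP m →+* MP m :=
  (rename (swap i.castSucc i.succ) : MP m →ₐ[Polynomial ℤ] MP m).toRingHom

theorem sw_X {m : ℕ} (i : Fin m) (j) : sw i (X j) = X (swap i.castSucc i.succ j) := by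
  simp [sw]

theorem sw_bb {m : ℕ} (i : Fin m) : sw i (bb m) = bb m := by
  simp [sw, bb]

theorem sw_sw {m : ℕ} (i : Fin m) (f : MP m) : sw i (sw i f) = f := by
  simp [sw, rename_rename]
  have : (⇑(swap i.castSucc i.succ) ∘ ⇑(swap i.castSucc i.succ)) = id := by
    funext j; simp
  rw [this]; simp

theorem atom_swap {m : ℕ} (lam : Fin (m+1) → ℕ) (w : Perm (Fin (m+1))) (i : Fin m)
    (h : w i.castSucc < w i.succ) :
    (X i.castSucc - X i.succ) * atom lam (w * toSwap i) =
      X i.succ * (1 + bb m * X i.castSucc) * (atom lam w - sw i (atom lam w)) := by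
  have e : sw i (atom lam w) = zfun (bb m) (List.ofFn fun j =>
      ((X (swap i.castSucc i.succ j) : MP m), m + 1 - (w j : ℕ))) (topL (List.ofFn lam)) := by
    rw [atom, zfun_map, sw_bb, List.map_ofFn]
    congr 2
    funext j
    simp [sw_X]
  rw [e]
  unfold atom
  have h1 := (w i.succ).isLt
  have h2 : (w i.castSucc : ℕ) < w i.succ := h
  apply zfun_ofFn_swap (bb m) (X i.castSucc) (X i.succ) (m + 1 - (w i.castSucc : ℕ))
    (m + 1 - (w i.succ : ℕ)) (by omega) (by omega) m i
  · intro j hj1 hj2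
    simp [toSwap, swap_apply_of_ne_of_ne hj1 hj2]
  all_goals simp [toSwap]

def Rel {m : ℕ} (i : Fin m) (f g : MP m) : Prop :=
  (X i.castSucc - X i.succ) * g = X i.castSucc * (1 + bb m * X i.succ) * f
    - X i.succ * (1 + bb m * X i.castSucc) * sw i f

theorem X_sub_ne {m : ℕ} (i : Fin m) : (X i.castSucc - X i.succ : MP m) ≠ 0 := by
  rw [sub_ne_zero]
  intro h
  have := MvPolynomial.X_injective h
  simp [Fin.ext_iff] at this

theorem Rel.piOp_eq {m : ℕ} {i : Fin m} {f g : MP m} (h : Rel i f g) : piOp i f = g := by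
  unfold piOp ddiff
  set F : MP m := X i.castSucc * f + C Polynomial.X * (X i.castSucc * (X i.succ * f)) with hF
  have hr : rename (swap i.castSucc i.succ) F = sw i F := rfl
  have e : F - rename (swap i.castSucc i.succ) F = (X i.castSucc - X i.succ) * g := by
    rw [hr, h, hF]
    have : (C Polynomial.X : MP m) = bb m := rfl
    simp only [this, map_add, map_mul, sw_bb, sw_X, swap_apply_left, swap_apply_right]
    ring
  have hd : (X i.castSucc - X i.succ : MP m) ∣ F - rename (swap i.castSucc i.succ) F :=
    ⟨g, e⟩
  rw [dif_pos hd]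
  have := e.symm.trans hd.choose_spec
  exact (mul_left_cancel₀ (X_sub_ne i) this).symm

theorem Rel.sum {m : ℕ} {i : Fin m} {ι : Type*} (s : Finset ι) (f g : ι → MP m)
    (h : ∀ v ∈ s, Rel i (f v) (g v)) : Rel i (∑ v ∈ s, f v) (∑ v ∈ s, g v) := by
  unfold Rel
  rw [map_sum, Finset.mul_sum, Finset.mul_sum, Finset.mul_sum, ← Finset.sum_sub_distrib]
  exact Finset.sum_congr rfl h

theorem rel_asc {m : ℕ} (lam : Fin (m+1) → ℕ) (w : Perm (Fin (m+1))) (i : Fin m)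
    (h : w i.castSucc < w i.succ) : Rel i (atom lam w) (atom lam w + atom lam (w * toSwap i)) := by
  unfold Rel
  linear_combination atom_swap lam w i h

theorem rel_desc {m : ℕ} (lam : Fin (m+1) → ℕ) (w : Perm (Fin (m+1))) (i : Fin m)
    (h : w i.succ < w i.castSucc) : Rel i (atom lam w) 0 := by
  have h1 := atom_swap lam (w * toSwap i) i (by simpa [toSwap] using h)
  rw [mul_assoc, toSwap_mul_self, mul_one] at h1
  have h2 := congrArg (sw i) h1
  simp only [map_add, map_sub, map_mul, map_one, sw_bb, sw_X, swap_apply_left, swap_apply_right,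
    sw_sw] at h2
  unfold Rel
  apply mul_left_cancel₀ (X_sub_ne i)
  linear_combination (-(X i.castSucc * (1 + bb m * X i.succ))) * h1
    - X i.succ * (1 + bb m * X i.castSucc) * h2

open Classical in
noncomputable def subs {m : ℕ} (l : List (Fin m)) : Finset (Perm (Fin (m+1))) :=
  Finset.univ.filter (Sub l)

theorem mem_subs {m : ℕ} (l : List (Fin m)) (v) : v ∈ subs l ↔ Sub l v := by
  simp [subs]

theorem sub_desc {m : ℕ} (l : List (Fin m)) (i : Fin m) (v : Perm (Fin (m+1))) (h : Sub l v)
    (hd : v i.succ < v i.castSucc) : Sub l (v * toSwap i) :=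
  h.down ⟨_, _, Fin.castSucc_lt_succ, hd, rfl⟩

theorem piWord_eq {m : ℕ} (lam : Fin (m+1) → ℕ) (hl : Antitone lam) (l : List (Fin m)) :
    piWord l (∏ i, (X i : MP m) ^ lam i) = ∑ v ∈ subs l, atom lam v := by
  classical
  induction l using List.reverseRecOn with
  | nil =>
    have : subs ([] : List (Fin m)) = {1} := by
      ext v
      rw [mem_subs, Finset.mem_singleton]
      constructor
      · rintro ⟨l', h1, rfl⟩
        rw [List.sublist_nil.1 h1]; simp
      · rintro rfl
        exact ⟨[], List.Sublist.refl _, by simp⟩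
    rw [this, Finset.sum_singleton, atom_one lam hl]
    rfl
  | append_singleton l i ih =>
    have e : piWord (l ++ [i]) (∏ i, (X i : MP m) ^ lam i)
        = piOp i (piWord l (∏ i, (X i : MP m) ^ lam i)) := by
      simp [piWord]
    rw [e, ih]
    have hR : Rel i (∑ v ∈ subs l, atom lam v) (∑ v ∈ subs l,
        if v i.castSucc < v i.succ then atom lam v + atom lam (v * toSwap i) else 0) := by
      apply Rel.sum
      intro v _
      split_ifs with h
      · exact rel_asc lam v i h
      · refine rel_desc lam v i (lt_of_le_of_ne (not_lt.1 h) fun h => ?_)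
        exact absurd (v.injective h) (by simp [Fin.ext_iff])
    rw [hR.piOp_eq, ← Finset.sum_filter, Finset.sum_add_distrib]
    rw [← Finset.sum_filter_add_sum_filter_not (subs (l ++ [i]))
      (fun v => v i.castSucc < v i.succ)]
    have hne : ∀ v : Perm (Fin (m+1)), v i.castSucc ≠ v i.succ := fun v h =>
      absurd (v.injective h) (by simp [Fin.ext_iff])
    have hasc : ∀ v : Perm (Fin (m+1)), v i.castSucc < v i.succ →
        (Sub (l ++ [i]) v ↔ Sub l v) := by
      intro v hv
      rw [sub_append]
      refine ⟨fun h => h.elim id fun h => ?_, Or.inl⟩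
      have := sub_desc l i _ h (by simpa [toSwap] using hv)
      rwa [mul_assoc, toSwap_mul_self, mul_one] at this
    congr 1
    · apply Finset.sum_congr _ fun _ _ => rfl
      ext v
      simp only [Finset.mem_filter, mem_subs]
      constructor
      · rintro ⟨h1, h2⟩; exact ⟨(hasc v h2).2 h1, h2⟩
      · rintro ⟨h1, h2⟩; exact ⟨(hasc v h2).1 h1, h2⟩
    · apply Finset.sum_bij' (fun v _ => v * toSwap i) (fun v _ => v * toSwap i)
      · intro v hv
        simp only [Finset.mem_filter, mem_subs] at hv ⊢
        refine ⟨(sub_append _ _ _).2 (Or.inr ?_), ?_⟩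
        · rw [mul_assoc, toSwap_mul_self, mul_one]; exact hv.1
        · simpa [toSwap] using hv.2.le
      · intro v hv
        simp only [Finset.mem_filter, mem_subs] at hv ⊢
        have hlt : v i.succ < v i.castSucc := lt_of_le_of_ne (not_lt.1 hv.2) (hne v).symm
        refine ⟨?_, by simpa [toSwap] using hlt⟩
        rcases (sub_append _ _ _).1 hv.1 with h | h
        · exact sub_desc l i v h hlt
        · exact h
      · intro v _; simp [mul_assoc, toSwap_mul_self]
      · intro v _; simp [mul_assoc, toSwap_mul_self]
      · intro v _; rfl

end LB

/-- For permutations `u ≤ w` in the Bruhat order and any partition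
`λ`, the difference of Lascoux polynomials `L_{w,λ} - L_{u,λ}` (computed from
reduced words `lw`, `lu`) has nonnegative coefficients. -/
theorem lascoux_bruhat_monotone (m : ℕ) (lam : Fin (m+1) → ℕ) (hlam : Antitone lam)
    (u w : Equiv.Perm (Fin (m+1))) (huw : BruhatLE u w)
    (lu lw : List (Fin m)) (hlu : IsReducedWord lu u) (hlw : IsReducedWord lw w)
    (mo : Fin (m+1) →₀ ℕ) (d : ℕ) :
    0 ≤ (MvPolynomial.coeff mo
        (piWord lw (∏ i, (X i : MvPolynomial (Fin (m+1)) (Polynomial ℤ)) ^ lam i) -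
         piWord lu (∏ i, (X i : MvPolynomial (Fin (m+1)) (Polynomial ℤ)) ^ lam i))).coeff d := by
  classical
  rw [LB.piWord_eq lam hlam lw, LB.piWord_eq lam hlam lu]
  have hsub : LB.subs lu ⊆ LB.subs lw := by
    intro v hv
    rw [LB.mem_subs] at hv ⊢
    exact LB.sub_of_bruhat u w huw lu lw hlu hlw v hv
  rw [← Finset.sum_sdiff hsub, add_sub_cancel_right]
  exact (sum_mem fun v _ => LB.atom_mem lam v :
    ∑ v ∈ LB.subs lw \ LB.subs lu, LB.atom lam v ∈ LB.nn m) mo d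
end
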